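/- Let m, n be positive integers and ξ a transcendental real number. Then min{w_m(ξ), ŵ_n(ξ)} ≤ m + n - 1. -/

import Mathlib

open Polynomial Filter

/-- Height of an integer polynomial: the maximum absolute value of its coefficients. -/
noncomputable def polyHeight (P : Polynomial ℤ) : ℝ :=
  ((P.support.sup fun i => (P.coeff i).natAbs : ℕ) : ℝ)

/-- `P` and `Q` have no common non-constant factor in `ℤ[X]`. -/
def CoprimePoly (P Q : Polynomial ℤ) : Prop :=
  ∀ d : Polynomial ℤ, d ∣ P → d ∣ Q → d.natDegree = 0

/-- The exponent `w_n(ξ)`. -/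
noncomputable def wExp (n : ℕ) (ξ : ℝ) : EReal :=
  sSup {x : EReal | ∃ w : ℝ, x = (w : EReal) ∧
    {P : Polynomial ℤ | P.natDegree ≤ n ∧ 0 < |Polynomial.aeval ξ P| ∧
      |Polynomial.aeval ξ P| ≤ (polyHeight P) ^ (-w)}.Infinite}

/-- The uniform exponent `ŵ_n(ξ)`. -/
noncomputable def whExp (n : ℕ) (ξ : ℝ) : EReal :=
  sSup {x : EReal | ∃ w : ℝ, x = (w : EReal) ∧
    ∀ᶠ H : ℝ in atTop, ∃ P : Polynomial ℤ, P.natDegree ≤ n ∧ polyHeight P ≤ H ∧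
      0 < |Polynomial.aeval ξ P| ∧ |Polynomial.aeval ξ P| ≤ H ^ (-w)}

/-- The exponent `w*_n(ξ)` of approximation by algebraic numbers of degree at most `n`;
the height of an algebraic number is the height of its irreducible defining polynomial. -/
noncomputable def wStarExp (n : ℕ) (ξ : ℝ) : EReal :=
  sSup {x : EReal | ∃ w : ℝ, x = (w : EReal) ∧
    {α : ℝ | ∃ P : Polynomial ℤ, Irreducible P ∧ Polynomial.aeval α P = 0 ∧
      P.natDegree ≤ n ∧ 0 < |ξ - α| ∧ |ξ - α| ≤ (polyHeight P) ^ (-w - 1)}.Infinite}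

/-- The uniform exponent `ŵ*_n(ξ)`. -/
noncomputable def whStarExp (n : ℕ) (ξ : ℝ) : EReal :=
  sSup {x : EReal | ∃ w : ℝ, x = (w : EReal) ∧
    ∀ᶠ H : ℝ in atTop, ∃ α : ℝ, ∃ P : Polynomial ℤ, Irreducible P ∧
      Polynomial.aeval α P = 0 ∧ P.natDegree ≤ n ∧ polyHeight P ≤ H ∧
      0 < |ξ - α| ∧ |ξ - α| ≤ (polyHeight P)⁻¹ * H ^ (-w)}

/-- The Mahler measure of an integer polynomial. -/
noncomputable abbrev intMahlerMeasure (P : ℤ[X]) : ℝ :=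
  P.mapMahlerMeasure (Int.castRingHom ℂ)

lemma isometry_intCastRingHom_complex : Isometry (Int.castRingHom ℂ) :=
  Isometry.of_dist_eq fun a b ↦ by
    rw [dist_eq_norm, dist_eq_norm, ← map_sub, eq_intCast, Complex.norm_intCast, Int.norm_eq_abs]

lemma intMahlerMeasure_dvd_le {P Q : ℤ[X]} (hQ : Q ≠ 0) (h : P ∣ Q) :
    intMahlerMeasure P ≤ intMahlerMeasure Q := by
  obtain ⟨R, rfl⟩ := h
  rw [intMahlerMeasure, intMahlerMeasure, mapMahlerMeasure_mul]
  exact le_mul_of_one_le_right (mapMahlerMeasure_nonneg _ _)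
    (one_le_mahlerMeasure_of_ne_zero (right_ne_zero_of_mul hQ))

lemma abs_coeff_le_polyHeight (P : ℤ[X]) (i : ℕ) : |(P.coeff i : ℝ)| ≤ polyHeight P := by
  rw [← Int.cast_abs, Int.abs_eq_natAbs, Int.cast_natCast, polyHeight, Nat.cast_le]
  by_cases hi : i ∈ P.support
  · exact Finset.le_sup (f := fun i ↦ (P.coeff i).natAbs) hi
  · simp [notMem_support_iff.mp hi]

lemma one_le_polyHeight {P : ℤ[X]} (hP : P ≠ 0) : 1 ≤ polyHeight P := by
  refine le_trans ?_ (abs_coeff_le_polyHeight P P.natDegree)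
  rw [← Int.cast_abs]
  exact_mod_cast Int.one_le_abs (leadingCoeff_ne_zero.mpr hP)

lemma intMahlerMeasure_le_mul_polyHeight {P : ℤ[X]} {n : ℕ} (hP : P.natDegree ≤ n) :
    intMahlerMeasure P ≤ (n + 1) * polyHeight P := by
  refine (mapMahlerMeasure_le_sum_norm_coeff _ _ isometry_intCastRingHom_complex).trans ?_
  rw [sum_over_range' _ (by simp) (n + 1) (by lia)]
  calc ∑ i ∈ Finset.range (n + 1), ‖P.coeff i‖
      ≤ ∑ _i ∈ Finset.range (n + 1), polyHeight P :=
        Finset.sum_le_sum fun i _ ↦ abs_coeff_le_polyHeight P i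
    _ = (n + 1) * polyHeight P := by simp

lemma abs_coeff_le_two_pow_mul_intMahlerMeasure {P : ℤ[X]} {m : ℕ} (hP : P.natDegree ≤ m)
    (i : ℕ) : |(P.coeff i : ℝ)| ≤ 2 ^ m * intMahlerMeasure P := by
  refine (norm_coeff_le_choose_mul_mapMahlerMeasure _ isometry_intCastRingHom_complex i P).trans ?_
  refine mul_le_mul_of_nonneg_right ?_ (mapMahlerMeasure_nonneg _ _)
  calc ((P.natDegree.choose i : ℕ) : ℝ) ≤ 2 ^ P.natDegree := mod_cast Nat.choose_le_two_pow _ _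
    _ ≤ 2 ^ m := pow_le_pow_right₀ one_le_two hP

/-- If the entries of a square matrix `A` are at most `x` and the entries of `v ᵥ* A` are at most
`y`, where `v 0 = 1`, then `A.det` is small. -/
lemma abs_det_le_of_abs_vecMul_le {N : ℕ} (A : Matrix (Fin (N + 1)) (Fin (N + 1)) ℝ)
    (v : Fin (N + 1) → ℝ) (hv : v 0 = 1) {x y : ℝ} (hA : ∀ i j, |A i j| ≤ x)
    (hvA : ∀ j, |Matrix.vecMul v A j| ≤ y) :
    |A.det| ≤ (N + 1) * (y * (N.factorial * x ^ N)) := by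
  have hdet : A.det = ∑ j, Matrix.vecMul v A j * A.adjugate j 0 := by
    have h := congrFun (Matrix.vecMul_vecMul v A A.adjugate) 0
    rw [Matrix.mul_adjugate, Matrix.vecMul_smul, Matrix.vecMul_one] at h
    simpa [hv, Matrix.vecMul, dotProduct] using h.symm
  have hadj (j : Fin (N + 1)) : |A.adjugate j 0| ≤ N.factorial * x ^ N := by
    rw [Matrix.adjugate_fin_succ_eq_det_submatrix, abs_mul, abs_pow, abs_neg, abs_one, one_pow,
      one_mul]
    have h := Matrix.det_le (abv := AbsoluteValue.abs) (x := x)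
      (A := A.submatrix (Fin.succAbove 0) (Fin.succAbove j)) fun i k ↦ hA _ _
    simpa using h
  have hy : 0 ≤ y := (abs_nonneg _).trans (hvA 0)
  rw [hdet]
  calc |∑ j, Matrix.vecMul v A j * A.adjugate j 0|
      ≤ ∑ j, |Matrix.vecMul v A j * A.adjugate j 0| := Finset.abs_sum_le_sum_abs _ _
    _ ≤ ∑ _j : Fin (N + 1), y * (N.factorial * x ^ N) := by
        gcongr with j
        rw [abs_mul]
        exact mul_le_mul (hvA j) (hadj j) (abs_nonneg _) hy
    _ = (N + 1) * (y * (N.factorial * x ^ N)) := by simp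

lemma sum_ite_mem_Icc_pow_mul_coeff {R : Type*} [CommRing R] (f : R[X]) (t : R) {N j e : ℕ}
    (hN : j + e < N) (hf : f.natDegree ≤ e) :
    ∑ i : Fin N, t ^ (i : ℕ) * (if (i : ℕ) ∈ Set.Icc j (j + e) then f.coeff (i - j) else 0) =
      t ^ j * f.eval t := by
  have hdeg : (X ^ j * f).natDegree < N :=
    (natDegree_mul_le.trans (Nat.add_le_add (natDegree_X_pow_le j) hf)).trans_lt hN
  have heval := eval_eq_sum_range' hdeg t
  rw [eval_mul, eval_pow, eval_X] at heval
  rw [heval, Finset.sum_range]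
  refine Finset.sum_congr rfl fun i _ ↦ ?_
  rw [mul_comm, coeff_X_pow_mul']
  congr 1
  by_cases h₁ : j ≤ (i : ℕ) <;> by_cases h₂ : (i : ℕ) ≤ j + e <;> simp [Set.mem_Icc, h₁, h₂]
  exact (coeff_eq_zero_of_natDegree_lt (by lia)).symm

/-- The powers of `t` form an approximate left null vector of the Sylvester matrix when both
polynomials are small at `t`. -/
lemma vecMul_sylvester_pow {R : Type*} [CommRing R] (f g : R[X]) (t : R) {d e : ℕ}
    (hf : f.natDegree ≤ d) (hg : g.natDegree ≤ e) (j : Fin (d + e)) :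
    Matrix.vecMul (fun i : Fin (d + e) ↦ t ^ (i : ℕ)) (sylvester f g d e) j =
      j.addCases (fun k ↦ t ^ (k : ℕ) * g.eval t) (fun k ↦ t ^ (k : ℕ) * f.eval t) := by
  induction j using Fin.addCases with
  | left k =>
    simpa [Matrix.vecMul, dotProduct, sylvester] using
      sum_ite_mem_Icc_pow_mul_coeff g t (N := d + e) (j := k) (by lia) hg
  | right k =>
    simpa [Matrix.vecMul, dotProduct, sylvester] using
      sum_ite_mem_Icc_pow_mul_coeff f t (N := d + e) (j := k) (by lia) hf

lemma abs_resultant_le (f g : ℝ[X]) (t : ℝ) {d e : ℕ} (hde : 0 < d + e) (hf : f.natDegree ≤ d)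
    (hg : g.natDegree ≤ e) {x y : ℝ} (hfx : ∀ i, |f.coeff i| ≤ x) (hgx : ∀ i, |g.coeff i| ≤ x)
    (hfy : |f.eval t| ≤ y) (hgy : |g.eval t| ≤ y) :
    |f.resultant g d e| ≤
      (d + e) * ((1 + |t|) ^ (d + e) * y * ((d + e - 1).factorial * x ^ (d + e - 1))) := by
  have hx : 0 ≤ x := (abs_nonneg _).trans (hfx 0)
  have hpow (k : ℕ) (hk : k ≤ d + e) {z : ℝ} (hz : |z| ≤ y) :
      |t ^ k * z| ≤ (1 + |t|) ^ (d + e) * y := by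
    rw [abs_mul, abs_pow]
    refine mul_le_mul ?_ hz (abs_nonneg _) (by positivity)
    calc |t| ^ k ≤ (1 + |t|) ^ k := by gcongr; simp
      _ ≤ (1 + |t|) ^ (d + e) := pow_le_pow_right₀ (by simp) hk
  have hentry (i j : Fin (d + e)) : |sylvester f g d e i j| ≤ x := by
    induction j using Fin.addCases <;> simp only [sylvester, Matrix.of_apply, Fin.addCases_left,
      Fin.addCases_right] <;> split_ifs <;> simp [hfx, hgx, hx]
  have hvec (j : Fin (d + e)) :
      |Matrix.vecMul (fun i : Fin (d + e) ↦ t ^ (i : ℕ)) (sylvester f g d e) j| ≤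
        (1 + |t|) ^ (d + e) * y := by
    rw [vecMul_sylvester_pow f g t hf hg]
    induction j using Fin.addCases with
    | left k => simpa using hpow k (by lia) hgy
    | right k => simpa using hpow k (by lia) hfy
  rw [resultant]
  generalize sylvester f g d e = A at hentry hvec
  rw [show (d : ℝ) + e = ((d + e : ℕ) : ℝ) by push_cast; ring]
  generalize d + e = N at *
  obtain _ | N := N
  · lia
  simpa using abs_det_le_of_abs_vecMul_le A _ (by simp) hentry hvec

lemma resultant_ne_zero_of_irreducible_of_not_dvd {P Q : ℤ[X]} (hP : Irreducible P)
    (hd : P.natDegree ≠ 0) (h : ¬ P ∣ Q) : P.resultant Q ≠ 0 := by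
  have hprim : P.IsPrimitive := hP.isPrimitive hd
  have hirr := hprim.irreducible_iff_irreducible_map_fraction_map (K := ℚ) |>.mp hP
  have hdvd : ¬ P.map (algebraMap ℤ ℚ) ∣ Q.map (algebraMap ℤ ℚ) := fun h' ↦
    h (hprim.dvd_of_fraction_map_dvd_fraction_map h')
  have hres := resultant_ne_zero _ _ ((hirr.coprime_iff_not_dvd).mpr hdvd)
  intro h0
  apply hres
  rw [natDegree_map_eq_of_injective (algebraMap ℤ ℚ).injective_int,
    natDegree_map_eq_of_injective (algebraMap ℤ ℚ).injective_int, resultant_map_map, h0, map_zero]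

/-- Two coprime integer polynomials cannot both be very small at the same point. -/
lemma exists_one_le_mul_of_irreducible_of_not_dvd (m n : ℕ) (ξ : ℝ) :
    ∃ C : ℝ, 0 < C ∧ ∀ P Q : ℤ[X], Irreducible P → P.natDegree ≠ 0 → P.natDegree ≤ m →
      Q.natDegree ≤ n → ¬ P ∣ Q → ∀ x y : ℝ, 1 ≤ x → (∀ i, |(P.coeff i : ℝ)| ≤ x) →
      (∀ i, |(Q.coeff i : ℝ)| ≤ x) → |aeval ξ P| ≤ y → |aeval ξ Q| ≤ y →
      1 ≤ C * x ^ (m + n - 1) * y := by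
  refine ⟨(m + n + 1) * ((1 + |ξ|) ^ (m + n) * (m + n).factorial), by positivity, ?_⟩
  intro P Q hP hd hPm hQn hPQ x y hx hPx hQx hPy hQy
  have hy : 0 ≤ y := (abs_nonneg _).trans hPy
  have hinj : Function.Injective (Int.castRingHom ℝ) := (Int.castRingHom ℝ).injective_int
  have hle := abs_resultant_le (P.map (Int.castRingHom ℝ)) (Q.map (Int.castRingHom ℝ)) ξ
    (d := P.natDegree) (e := Q.natDegree) (by lia) natDegree_map_le natDegree_map_le
    (by simpa using hPx) (by simpa using hQx) (by simpa [aeval_def, eval_map] using hPy)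
    (by simpa [aeval_def, eval_map] using hQy)
  rw [resultant_map_map] at hle
  have hone : (1 : ℝ) ≤ |Int.castRingHom ℝ (P.resultant Q)| := by
    rw [eq_intCast, ← Int.cast_abs]
    exact_mod_cast Int.one_le_abs (resultant_ne_zero_of_irreducible_of_not_dvd hP hd hPQ)
  refine (hone.trans hle).trans ?_
  have hdeg : P.natDegree + Q.natDegree ≤ m + n := Nat.add_le_add hPm hQn
  calc _ ≤ ((m : ℝ) + n + 1) * ((1 + |ξ|) ^ (m + n) * y *
        ((m + n).factorial * x ^ (m + n - 1))) := by
        gcongr ?_ * (?_ * y * (?_ * ?_))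
        · exact_mod_cast hdeg.trans (Nat.le_succ _)
        · exact pow_le_pow_right₀ (by simp) hdeg
        · exact_mod_cast Nat.factorial_le (by lia)
        · exact pow_le_pow_right₀ hx (by lia)
    _ = _ := by ring

/-- A lower bound for irreducible polynomials at `ξ` propagates to all polynomials. -/
lemma pow_natDegree_mul_rpow_le_abs_aeval {m : ℕ} {ξ c w : ℝ} (hc : 0 < c) (hw : 0 ≤ w)
    (h : ∀ P : ℤ[X], Irreducible P → P.natDegree ≠ 0 → P.natDegree ≤ m →
      c * intMahlerMeasure P ^ (-w) ≤ |aeval ξ P|) (P : ℤ[X]) (hP : P ≠ 0)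
    (hm : P.natDegree ≤ m) (hc1 : c ≤ 1) :
    c ^ P.natDegree * intMahlerMeasure P ^ (-w) ≤ |aeval ξ P| := by
  have hconst (a : ℤ) (ha : a ≠ 0) : intMahlerMeasure (C a) ^ (-w) ≤ |aeval ξ (C a)| := by
    have h1 : (1 : ℝ) ≤ |(a : ℝ)| := by
      rw [← Int.cast_abs]; exact_mod_cast Int.one_le_abs ha
    have hle : intMahlerMeasure (C a) ^ (-w) ≤ 1 :=
      Real.rpow_le_one_of_one_le_of_nonpos
        (one_le_mahlerMeasure_of_ne_zero (C_ne_zero.mpr ha)) (by linarith)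
    simpa using hle.trans h1
  induction P using UniqueFactorizationMonoid.induction_on_prime with
  | h₁ => exact absurd rfl hP
  | h₂ x hx =>
    obtain ⟨a, ha, rfl⟩ := isUnit_iff.mp hx
    simpa using hconst a ha.ne_zero
  | h₃ a p ha hp ih =>
    have hdeg : (p * a).natDegree = p.natDegree + a.natDegree := natDegree_mul hp.ne_zero ha
    have iha := ih ha (by lia)
    have hbase : c ^ p.natDegree * intMahlerMeasure p ^ (-w) ≤ |aeval ξ p| := by
      by_cases hd : p.natDegree = 0
      · obtain ⟨b, rfl⟩ := natDegree_eq_zero.mp hd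
        simpa using hconst b (C_ne_zero.mp hp.ne_zero)
      · refine le_trans ?_ (h p hp.irreducible hd (by lia))
        gcongr
        · exact Real.rpow_nonneg (mapMahlerMeasure_nonneg _ _) _
        · exact pow_le_of_le_one hc.le hc1 hd
    rw [map_mul, abs_mul, hdeg, pow_add, intMahlerMeasure, mapMahlerMeasure_mul,
      Real.mul_rpow (mapMahlerMeasure_nonneg _ _) (mapMahlerMeasure_nonneg _ _)]
    calc _ = (c ^ p.natDegree * intMahlerMeasure p ^ (-w)) *
          (c ^ a.natDegree * intMahlerMeasure a ^ (-w)) := by ring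
      _ ≤ _ := mul_le_mul hbase iha
        (mul_nonneg (by positivity) (Real.rpow_nonneg (mapMahlerMeasure_nonneg _ _) _))
        (abs_nonneg _)

lemma finite_intMahlerMeasure_le (n : ℕ) (B : ℝ) :
    {P : ℤ[X] | P.natDegree ≤ n ∧ intMahlerMeasure P ≤ B}.Finite := by
  refine (finite_mahlerMeasure_le n B.toNNReal).subset fun P hP ↦ ⟨hP.1, hP.2.trans ?_⟩
  exact Real.le_coe_toNNReal B

/-- Good uniform approximation in degree `n` forces irreducible polynomials of degree at most `m`
and large Mahler measure to be bounded from below at `ξ`. -/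
lemma exists_rpow_lt_abs_aeval_of_irreducible {m n : ℕ} {ξ w : ℝ} (hm : 1 ≤ m)
    (hw : (m : ℝ) + n - 1 < w)
    (h : ∀ᶠ H : ℝ in atTop, ∃ P : ℤ[X], P.natDegree ≤ n ∧ polyHeight P ≤ H ∧
      0 < |aeval ξ P| ∧ |aeval ξ P| ≤ H ^ (-w)) :
    ∃ B : ℝ, ∀ P : ℤ[X], Irreducible P → P.natDegree ≠ 0 → P.natDegree ≤ m →
      B ≤ intMahlerMeasure P → intMahlerMeasure P ^ (-w) < |aeval ξ P| := by
  obtain ⟨C, hC, hres⟩ := exists_one_le_mul_of_irreducible_of_not_dvd m n ξ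
  have hcast : ((m + n - 1 : ℕ) : ℝ) = (m : ℝ) + n - 1 := by
    rw [Nat.cast_sub (by lia)]; push_cast; ring
  set K : ℝ := 2 ^ m * (n + 2) with hK
  have hK1 : 1 ≤ K := by
    have : (1 : ℝ) ≤ 2 ^ m := one_le_pow₀ one_le_two
    have : (0 : ℝ) ≤ n := n.cast_nonneg
    nlinarith
  have hlim : Tendsto (fun H : ℝ ↦ C * K ^ (m + n - 1) * H ^ (-(w - (m + n - 1)))) atTop
      (nhds (C * K ^ (m + n - 1) * 0)) :=
    (tendsto_rpow_neg_atTop (by linarith)).const_mul _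
  rw [mul_zero] at hlim
  obtain ⟨B, hB⟩ := eventually_atTop.mp
    ((h.and (hlim.eventually_lt_const one_pos)).and (eventually_ge_atTop 1))
  refine ⟨(n + 2) * B, fun P hP hd hPm hBP ↦ ?_⟩
  by_contra! hsmall
  set H : ℝ := intMahlerMeasure P / (n + 2) with hH
  have hn2 : (0 : ℝ) < n + 2 := by positivity
  have hPH : intMahlerMeasure P = (n + 2) * H := by rw [hH]; field_simp
  obtain ⟨⟨⟨Q, hQn, hQH, hQ0, hQ⟩, hlt⟩, hH1⟩ := hB H (by rw [hH, le_div_iff₀ hn2]; linarith)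
  have hH0 : 0 < H := by linarith
  have hQne : Q ≠ 0 := by rintro rfl; simp at hQ0
  have hndvd : ¬ P ∣ Q := fun hdvd ↦ by
    have h1 := intMahlerMeasure_dvd_le hQne hdvd
    have h2 := intMahlerMeasure_le_mul_polyHeight hQn
    have h3 : ((n : ℝ) + 1) * polyHeight Q ≤ (n + 1) * H := by gcongr
    rw [hPH] at h1
    linarith
  have hPy : |aeval ξ P| ≤ H ^ (-w) := by
    refine hsmall.trans (Real.rpow_le_rpow_of_nonpos hH0 ?_ ?_)
    · rw [hPH]; nlinarith [(n.cast_nonneg : (0 : ℝ) ≤ n)]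
    · have : (1 : ℝ) ≤ m := by exact_mod_cast hm
      linarith [(n.cast_nonneg : (0 : ℝ) ≤ n)]
  have hone := hres P Q hP hd hPm hQn hndvd (K * H) (H ^ (-w)) (by nlinarith)
    (fun i ↦ (abs_coeff_le_two_pow_mul_intMahlerMeasure hPm i).trans (by rw [hPH, hK, mul_assoc]))
    (fun i ↦ (abs_coeff_le_polyHeight Q i).trans (hQH.trans (by nlinarith))) hPy hQ
  have hpow : H ^ (-(w - (m + n - 1))) = H ^ (m + n - 1) * H ^ (-w) := by
    rw [← Real.rpow_natCast, ← Real.rpow_add hH0, hcast]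
    congr 1; ring
  rw [hpow] at hlt
  rw [mul_pow] at hone
  linarith

lemma exists_pos_mul_rpow_le_abs_aeval {m : ℕ} {ξ w B : ℝ} (hξ : Transcendental ℚ ξ)
    (h : ∀ P : ℤ[X], Irreducible P → P.natDegree ≠ 0 → P.natDegree ≤ m →
      B ≤ intMahlerMeasure P → intMahlerMeasure P ^ (-w) < |aeval ξ P|) :
    ∃ c : ℝ, 0 < c ∧ c ≤ 1 ∧ ∀ P : ℤ[X], Irreducible P → P.natDegree ≠ 0 → P.natDegree ≤ m →
      c * intMahlerMeasure P ^ (-w) ≤ |aeval ξ P| := by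
  have hξ' : Transcendental ℤ ξ := fun h' ↦ hξ ((IsFractionRing.isAlgebraic_iff ℤ ℚ ℝ).mp h')
  have hfin := (finite_intMahlerMeasure_le m B)
  have hsmall : ∀ᶠ c : ℝ in nhdsWithin 0 (Set.Ioi 0),
      ∀ P ∈ {P : ℤ[X] | P.natDegree ≤ m ∧ intMahlerMeasure P ≤ B},
        P ≠ 0 → c * intMahlerMeasure P ^ (-w) < |aeval ξ P| := by
    rw [eventually_all_finite hfin]
    intro P _
    by_cases hP : P = 0
    · simp [hP]
    have hpos : 0 < |aeval ξ P| := abs_pos.mpr fun h0 ↦ hP (transcendental_iff.mp hξ' P h0)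
    have hlim : Tendsto (fun c : ℝ ↦ c * intMahlerMeasure P ^ (-w)) (nhdsWithin 0 (Set.Ioi 0))
        (nhds (0 * intMahlerMeasure P ^ (-w))) :=
      (tendsto_id.mono_left nhdsWithin_le_nhds).mul_const _
    rw [zero_mul] at hlim
    filter_upwards [hlim.eventually_lt_const hpos] with c hc _ using hc
  obtain ⟨c, hc, hc0, hc1⟩ :=
    (hsmall.and (Ioc_mem_nhdsGT (show (0 : ℝ) < 1 from one_pos))).exists
  refine ⟨c, hc0, hc1, fun P hP hd hPm ↦ ?_⟩
  rcases le_total (intMahlerMeasure P) B with hPB | hPB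
  · exact (hc P ⟨hPm, hPB⟩ hP.ne_zero).le
  · refine le_trans ?_ (h P hP hd hPm hPB).le
    exact mul_le_of_le_one_left (Real.rpow_nonneg (mapMahlerMeasure_nonneg _ _) _) hc1

lemma finite_setOf_abs_aeval_le_rpow {m : ℕ} {ξ w w' k : ℝ} (hk : 0 < k) (hw : 0 ≤ w)
    (hww' : w < w') (h : ∀ P : ℤ[X], P ≠ 0 → P.natDegree ≤ m →
      k * intMahlerMeasure P ^ (-w) ≤ |aeval ξ P|) :
    {P : ℤ[X] | P.natDegree ≤ m ∧ 0 < |aeval ξ P| ∧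
      |aeval ξ P| ≤ polyHeight P ^ (-w')}.Finite := by
  set k' : ℝ := k * (m + 1 : ℝ) ^ (-w) with hk'
  have hk'0 : 0 < k' := by positivity
  have hlim : Tendsto (fun H : ℝ ↦ H ^ (-(w' - w))) atTop (nhds 0) :=
    tendsto_rpow_neg_atTop (by linarith)
  obtain ⟨B, hB⟩ := eventually_atTop.mp (hlim.eventually_lt_const hk'0)
  refine (finite_intMahlerMeasure_le m ((m + 1) * B)).subset fun P ⟨hPm, hP0, hP⟩ ↦ ⟨hPm, ?_⟩
  have hPne : P ≠ 0 := by rintro rfl; simp at hP0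
  have hM := intMahlerMeasure_le_mul_polyHeight hPm
  have hM1 : 1 ≤ intMahlerMeasure P := one_le_mahlerMeasure_of_ne_zero hPne
  have hH0 : 0 < polyHeight P := one_pos.trans_le (one_le_polyHeight hPne)
  suffices polyHeight P ≤ B from hM.trans (by gcongr)
  by_contra! hlt
  have hlt' := hB _ hlt.le
  have hlow : k' * polyHeight P ^ (-w) ≤ polyHeight P ^ (-w') := by
    refine le_trans ?_ ((h P hPne hPm).trans hP)
    rw [hk', mul_assoc, ← Real.mul_rpow (by positivity) hH0.le]
    exact mul_le_mul_of_nonneg_left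
      (Real.rpow_le_rpow_of_nonpos (by linarith) hM (by linarith)) hk.le
  have hsplit : polyHeight P ^ (-w') = polyHeight P ^ (-(w' - w)) * polyHeight P ^ (-w) := by
    rw [← Real.rpow_add hH0]; congr 1; ring
  rw [hsplit] at hlow
  exact absurd (le_of_mul_le_mul_right hlow (Real.rpow_pos_of_pos hH0 _)) (not_le.mpr hlt')

theorem stmt3 (m n : ℕ) (hm : 1 ≤ m) (hn : 1 ≤ n) (ξ : ℝ) (hξ : Transcendental ℚ ξ) :
    min (wExp m ξ) (whExp n ξ) ≤ ((m : EReal) + (n : EReal) - 1) := by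
  have hcast : (m : EReal) + (n : EReal) - 1 = (((m : ℝ) + n - 1 : ℝ) : EReal) := by
    push_cast; rfl
  rw [hcast]
  by_contra! hlt
  obtain ⟨hlt₁, hlt₂⟩ := lt_min_iff.mp hlt
  obtain ⟨_, ⟨w₁, rfl, hinf⟩, hw₁⟩ := lt_sSup_iff.mp hlt₁
  obtain ⟨_, ⟨w₂, rfl, hunif⟩, hw₂⟩ := lt_sSup_iff.mp hlt₂
  rw [EReal.coe_lt_coe_iff] at hw₁ hw₂
  obtain ⟨w, hw, hw'⟩ := exists_between (lt_min hw₁ hw₂)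
  obtain ⟨hww₁, hww₂⟩ := lt_min_iff.mp hw'
  have hw0 : 0 ≤ w := by
    have : (1 : ℝ) ≤ m := by exact_mod_cast hm
    linarith [(n.cast_nonneg : (0 : ℝ) ≤ n)]
  have hunif' : ∀ᶠ H : ℝ in atTop, ∃ P : ℤ[X], P.natDegree ≤ n ∧ polyHeight P ≤ H ∧
      0 < |aeval ξ P| ∧ |aeval ξ P| ≤ H ^ (-w) := by
    filter_upwards [hunif, eventually_ge_atTop 1] with H ⟨P, hPn, hPH, hP0, hP⟩ hH
    exact ⟨P, hPn, hPH, hP0, hP.trans (Real.rpow_le_rpow_of_exponent_le hH (by linarith))⟩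
  obtain ⟨B, hB⟩ := exists_rpow_lt_abs_aeval_of_irreducible hm hw hunif'
  obtain ⟨c, hc0, hc1, hc⟩ := exists_pos_mul_rpow_le_abs_aeval hξ hB
  refine hinf (finite_setOf_abs_aeval_le_rpow (k := c ^ m) (pow_pos hc0 m) hw0 hww₁ ?_)
  intro P hP hPm
  refine le_trans ?_ (pow_natDegree_mul_rpow_le_abs_aeval hc0 hw0 hc P hP hPm hc1)
  exact mul_le_mul_of_nonneg_right (pow_le_pow_of_le_one hc0.le hc1 hPm)
    (Real.rpow_nonneg (mapMahlerMeasure_nonneg _ _) _)
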